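/- Fix α > 0, λ ∈ (0,1], and n ∈ ℕ, and let d_α(n) = d_α(p_{n;λ}, q_λ). Then the following double inequality holds: (α^n λ^{n+1}/(n+1)!) · (1 + αλ/(n+2) + α²λ²/((n+2)(n+3))) < d_α(n) < (α^n λ^{n+1}/(n+1)!) · (1 + αλ/(n+2) + α²λ² e^{αλ}/((n+2)(n+3))). -/

import Mathlib

open scoped BigOperators ENNReal

/-- A probability mass function on ℕ. -/
def IsPmf (p : ℕ → ℝ) : Prop := (∀ j, 0 ≤ p j) ∧ ∑' j, p j = 1

/-- Total variation distance between two pmfs on ℕ. -/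
noncomputable def dtv (p q : ℕ → ℝ) : ℝ := (1 / 2) * ∑' j, |p j - q j|

/-- Descending factorial (j)_k = j(j-1)⋯(j-k+1), as a real number. -/
noncomputable def descFac (j k : ℕ) : ℝ := ∏ i ∈ Finset.range k, ((j : ℝ) - i)

/-- k-th descending factorial moment of a pmf p. -/
noncomputable def facMoment (k : ℕ) (p : ℕ → ℝ) : ℝ := ∑' j, descFac j k * p j

/-- Factorial moment distance of order α, with values in [0,∞]:
    d_α(p,q) = ∑_{k=1}^∞ (α^{k-1}/k!) |M_k(p) - M_k(q)|. -/
noncomputable def dFM (α : ℝ) (p q : ℕ → ℝ) : ℝ≥0∞ :=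
  ∑' k : ℕ, ENNReal.ofReal
    (α ^ k / (Nat.factorial (k + 1) : ℝ) * |facMoment (k + 1) p - facMoment (k + 1) q|)

/-- The Poisson(λ) pmf. -/
noncomputable def poissonPmf (lam : ℝ) (j : ℕ) : ℝ :=
  Real.exp (-lam) * lam ^ j / (Nat.factorial j : ℝ)

/-- The generalized matching pmf p_{n;λ}. -/
noncomputable def genMatch (n : ℕ) (lam : ℝ) (j : ℕ) : ℝ :=
  if j ≤ n then
    lam ^ j / (Nat.factorial j : ℝ) * ∑ i ∈ Finset.range (n - j + 1), (-lam) ^ i / (Nat.factorial i : ℝ)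
  else 0

theorem descFac_eq_descFactorial (j k : ℕ) : descFac j k = (j.descFactorial k : ℝ) := by
  induction k with
  | zero => simp [descFac]
  | succ k ih =>
    have hsucc : descFac j (k + 1) = descFac j k * ((j : ℝ) - k) := Finset.prod_range_succ _ _
    rw [hsucc, ih, Nat.descFactorial_succ]
    rcases le_or_gt k j with h | h
    · push_cast [Nat.cast_sub h]
      ring
    · simp [Nat.descFactorial_of_lt h]

theorem descFac_add_div_factorial (i k : ℕ) :
    descFac (i + k) k / (Nat.factorial (i + k) : ℝ) = 1 / (Nat.factorial i : ℝ) := by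
  have h := Nat.factorial_mul_descFactorial (Nat.le_add_left k i)
  rw [Nat.add_sub_cancel] at h
  rw [descFac_eq_descFactorial, ← h]
  have h1 : ((i + k).descFactorial k : ℝ) ≠ 0 := by
    exact_mod_cast (Nat.descFactorial_pos.2 (Nat.le_add_left k i)).ne'
  have h2 := Nat.cast_ne_zero (R := ℝ).2 (Nat.factorial_ne_zero i)
  push_cast
  field_simp

/-- Only the indices `j ≥ k` contribute to the `k`-th factorial moment. -/
theorem facMoment_eq_tsum_add (k : ℕ) (p : ℕ → ℝ) :
    facMoment k p = ∑' i, descFac (i + k) k * p (i + k) := by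
  refine ((add_left_injective k).tsum_eq ?_).symm
  intro j hj
  have hkj : k ≤ j := by
    by_contra! h
    exact hj (by simp [descFac_eq_descFactorial, Nat.descFactorial_of_lt h])
  exact ⟨j - k, Nat.sub_add_cancel hkj⟩

theorem facMoment_poissonPmf (k : ℕ) (lam : ℝ) : facMoment k (poissonPmf lam) = lam ^ k := by
  rw [facMoment_eq_tsum_add]
  have hterm : ∀ i, descFac (i + k) k * poissonPmf lam (i + k)
      = Real.exp (-lam) * lam ^ k * (lam ^ i / (Nat.factorial i : ℝ)) := fun i => by
    calc _ = Real.exp (-lam) * lam ^ (i + k)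
          * (descFac (i + k) k / (Nat.factorial (i + k) : ℝ)) := by
          rw [poissonPmf]; ring
      _ = _ := by rw [descFac_add_div_factorial]; ring
  have hexp : ∑' i : ℕ, lam ^ i / (Nat.factorial i : ℝ) = Real.exp lam := by
    rw [Real.exp_eq_exp_ℝ, NormedSpace.exp_eq_tsum_div]
  simp_rw [hterm]
  rw [tsum_mul_left, hexp, mul_right_comm, ← Real.exp_add]
  simp

/-- The degree-`m` part of `exp x * exp y` is that of `exp (x + y)`. -/
theorem sum_range_pow_div_factorial_mul (x y : ℝ) (m : ℕ) :
    ∑ k ∈ Finset.range (m + 1), x ^ k / (Nat.factorial k : ℝ)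
        * (y ^ (m - k) / (Nat.factorial (m - k) : ℝ))
      = (x + y) ^ m / (Nat.factorial m : ℝ) := by
  rw [add_pow, Finset.sum_div]
  refine Finset.sum_congr rfl fun k hk => ?_
  rw [Nat.cast_choose ℝ (Nat.lt_succ_iff.1 (Finset.mem_range.1 hk))]
  have := Nat.cast_ne_zero (R := ℝ).2 (Nat.factorial_ne_zero m)
  field_simp

theorem sum_range_pow_div_factorial_mul_sum_neg (x : ℝ) (N : ℕ) :
    ∑ i ∈ Finset.range (N + 1), x ^ i / (Nat.factorial i : ℝ)
        * ∑ l ∈ Finset.range (N + 1 - i), (-x) ^ l / (Nat.factorial l : ℝ) = 1 := by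
  simp_rw [Finset.mul_sum]
  rw [← Finset.sum_range_diag_flip (N + 1)
    fun i l => x ^ i / (Nat.factorial i : ℝ) * ((-x) ^ l / (Nat.factorial l : ℝ))]
  simp_rw [sum_range_pow_div_factorial_mul, add_neg_cancel]
  simp [Finset.sum_range_succ']

theorem facMoment_genMatch_of_le {k n : ℕ} (h : k ≤ n) (lam : ℝ) :
    facMoment k (genMatch n lam) = lam ^ k := by
  obtain ⟨N, rfl⟩ := Nat.exists_eq_add_of_le h
  rw [facMoment_eq_tsum_add, tsum_eq_sum (s := Finset.range (N + 1))]
  · rw [← mul_one (lam ^ k), ← sum_range_pow_div_factorial_mul_sum_neg lam N, Finset.mul_sum]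
    refine Finset.sum_congr rfl fun i hi => ?_
    have hi := Finset.mem_range.1 hi
    rw [genMatch, if_pos (by lia), show k + N - (i + k) + 1 = N + 1 - i by lia]
    calc _ = lam ^ (i + k) * (descFac (i + k) k / (Nat.factorial (i + k) : ℝ))
          * ∑ l ∈ Finset.range (N + 1 - i), (-lam) ^ l / (Nat.factorial l : ℝ) := by ring
      _ = _ := by rw [descFac_add_div_factorial]; ring
  · intro i hi
    have hi : N + 1 ≤ i := by simpa using hi
    rw [genMatch, if_neg (by lia), mul_zero]

theorem facMoment_genMatch_of_lt {k n : ℕ} (h : n < k) (lam : ℝ) :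
    facMoment k (genMatch n lam) = 0 := by
  rw [facMoment_eq_tsum_add]
  simp [genMatch, show ∀ i, ¬ i + k ≤ n by lia]

/-- The terms of `∑_{k > n} α ^ (k - 1) * lam ^ k / k!`, the series of the distance between the
generalized matching and the Poisson pmf. -/
noncomputable def tailTerm (α lam : ℝ) (n m : ℕ) : ℝ :=
  α ^ (m + n) * lam ^ (m + n + 1) / (Nat.factorial (m + n + 1) : ℝ)

theorem tailTerm_pos {α lam : ℝ} (hα : 0 < α) (hlam : 0 < lam) (n m : ℕ) :
    0 < tailTerm α lam n m := by
  rw [tailTerm]; positivity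

theorem dFM_genMatch_poissonPmf (α : ℝ) {lam : ℝ} (hlam : 0 < lam) (n : ℕ) :
    dFM α (genMatch n lam) (poissonPmf lam) = ∑' m, ENNReal.ofReal (tailTerm α lam n m) := by
  have hsupp : ∀ k < n, α ^ k / (Nat.factorial (k + 1) : ℝ)
      * |facMoment (k + 1) (genMatch n lam) - facMoment (k + 1) (poissonPmf lam)| = 0 :=
    fun k hk => by
      rw [facMoment_genMatch_of_le hk, facMoment_poissonPmf, sub_self, abs_zero, mul_zero]
  rw [dFM, ← (add_left_injective n).tsum_eq]
  · refine tsum_congr fun m => ?_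
    rw [facMoment_genMatch_of_lt (by lia), facMoment_poissonPmf, zero_sub, abs_neg,
      abs_of_pos (by positivity), tailTerm]
    congr 1
    ring
  · intro k hk
    have hnk : n ≤ k := by
      by_contra! h
      exact hk (by simp only [hsupp k h, ENNReal.ofReal_zero])
    exact ⟨k - n, Nat.sub_add_cancel hnk⟩

/-- Comparison of the tail series from its third term on with an exponential series. -/
theorem tailTerm_add_two_le {α lam : ℝ} (hα : 0 < α) (hlam : 0 < lam) (n m : ℕ) :
    tailTerm α lam n (m + 2)
      ≤ tailTerm α lam n 2 * ((α * lam) ^ m / (Nat.factorial m : ℝ)) := by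
  have hfac : ((Nat.factorial (2 + n + 1) : ℝ) * Nat.factorial m)
      ≤ Nat.factorial (m + 2 + n + 1) := by
    rw [show m + 2 + n + 1 = 2 + n + 1 + m by ring]
    exact_mod_cast Nat.le_of_dvd (Nat.factorial_pos _)
      (Nat.factorial_mul_factorial_dvd_factorial_add _ _)
  calc tailTerm α lam n (m + 2)
      ≤ α ^ (m + 2 + n) * lam ^ (m + 2 + n + 1)
          / ((Nat.factorial (2 + n + 1) : ℝ) * Nat.factorial m) := by
        rw [tailTerm]; gcongr
    _ = _ := by rw [tailTerm]; field_simp; ring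

theorem tailTerm_three_lt {α lam : ℝ} (hα : 0 < α) (hlam : 0 < lam) (n : ℕ) :
    tailTerm α lam n (1 + 2)
      < tailTerm α lam n 2 * ((α * lam) ^ 1 / (Nat.factorial 1 : ℝ)) := by
  have hfac : (Nat.factorial (2 + n + 1) : ℝ) < Nat.factorial (1 + 2 + n + 1) := by
    exact_mod_cast (Nat.factorial_lt (Nat.succ_pos _)).2 (by lia)
  calc tailTerm α lam n (1 + 2)
      < α ^ (1 + 2 + n) * lam ^ (1 + 2 + n + 1) / (Nat.factorial (2 + n + 1) : ℝ) := by
        rw [tailTerm]; gcongr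
    _ = _ := by rw [tailTerm, Nat.factorial_one, Nat.cast_one]; field_simp; ring

theorem hasSum_tailTerm_two_mul (α lam : ℝ) (n : ℕ) :
    HasSum (fun m : ℕ => tailTerm α lam n 2 * ((α * lam) ^ m / (Nat.factorial m : ℝ)))
      (tailTerm α lam n 2 * Real.exp (α * lam)) := by
  rw [Real.exp_eq_exp_ℝ]
  exact (NormedSpace.expSeries_div_hasSum_exp (α * lam)).mul_left _

theorem summable_tailTerm {α lam : ℝ} (hα : 0 < α) (hlam : 0 < lam) (n : ℕ) :
    Summable (tailTerm α lam n) :=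
  (summable_nat_add_iff 2).1 <| (hasSum_tailTerm_two_mul α lam n).summable.of_nonneg_of_le
    (fun _ => (tailTerm_pos hα hlam n _).le) (tailTerm_add_two_le hα hlam n)

theorem tailTerm_head (α lam c : ℝ) (n : ℕ) :
    tailTerm α lam n 0 + tailTerm α lam n 1 + tailTerm α lam n 2 * c
      = α ^ n * lam ^ (n + 1) / (Nat.factorial (n + 1) : ℝ)
        * (1 + α * lam / ((n : ℝ) + 2)
          + α ^ 2 * lam ^ 2 * c / (((n : ℝ) + 2) * ((n : ℝ) + 3))) := by
  simp only [tailTerm, show 0 + n = n by ring, show 1 + n = n + 1 by ring,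
    show 2 + n = n + 1 + 1 by ring, Nat.factorial_succ (n + 1), Nat.factorial_succ (n + 1 + 1)]
  have := Nat.cast_ne_zero (R := ℝ).2 (Nat.factorial_ne_zero (n + 1))
  push_cast
  rw [show (n : ℝ) + 1 + 1 = n + 2 by ring, show (n : ℝ) + 2 + 1 = n + 3 by ring]
  field_simp
  ring

theorem stmt14 (α : ℝ) (hα : 0 < α) (lam : ℝ) (hlam : 0 < lam ∧ lam ≤ 1) (n : ℕ) :
    ENNReal.ofReal
        (α ^ n * lam ^ (n + 1) / (Nat.factorial (n + 1) : ℝ)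
          * (1 + α * lam / ((n : ℝ) + 2) + α ^ 2 * lam ^ 2 / (((n : ℝ) + 2) * ((n : ℝ) + 3))))
      < dFM α (genMatch n lam) (poissonPmf lam) ∧
    dFM α (genMatch n lam) (poissonPmf lam)
      < ENNReal.ofReal
          (α ^ n * lam ^ (n + 1) / (Nat.factorial (n + 1) : ℝ)
            * (1 + α * lam / ((n : ℝ) + 2)
                + α ^ 2 * lam ^ 2 * Real.exp (α * lam) / (((n : ℝ) + 2) * ((n : ℝ) + 3)))) := by
  obtain ⟨hlam, -⟩ := hlam
  have hpos := tailTerm_pos hα hlam n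
  have hsum := summable_tailTerm hα hlam n
  have hexp := hasSum_tailTerm_two_mul α lam n
  have hlower := hsum.sum_add_tsum_nat_add 3
  have hrest : 0 < ∑' m, tailTerm α lam n (m + 3) :=
    ((summable_nat_add_iff 3).2 hsum).tsum_pos (fun _ => (hpos _).le) 0 (hpos _)
  have hupper := hsum.sum_add_tsum_nat_add 2
  have htail : ∑' m, tailTerm α lam n (m + 2) < tailTerm α lam n 2 * Real.exp (α * lam) := by
    rw [← hexp.tsum_eq]
    exact ((summable_nat_add_iff 2).2 hsum).tsum_lt_tsum (tailTerm_add_two_le hα hlam n)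
      (tailTerm_three_lt hα hlam n) hexp.summable
  simp only [Finset.sum_range_succ, Finset.sum_range_zero, zero_add] at hlower hupper
  have hone := tailTerm_head α lam 1 n
  rw [mul_one, mul_one] at hone
  rw [dFM_genMatch_poissonPmf α hlam, ← ENNReal.ofReal_tsum_of_nonneg (fun _ => (hpos _).le) hsum,
    ← hone, ← tailTerm_head]
  have := hpos 0
  have := hpos 1
  have := hpos 2
  constructor
  · exact (ENNReal.ofReal_lt_ofReal_iff (by linarith)).2 (by linarith)
  · exact (ENNReal.ofReal_lt_ofReal_iff (by positivity)).2 (by linarith)
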